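/- Let (C_k)_{k≥1} be a sequence of positive real numbers and let (N_k)_{k≥1} be a sequence of nonnegative integers satisfying N_k ≥ ⌈C_k⌉ + k(4k+1) for all k ≥ 1. Then for every real number r with 0 < r < 1, the series Σ_{k=1}^∞ C_k · r^{N_k} / (1−r)^{4k+1} converges. -/

import Mathlib

/-- For `0 ≤ r < 1`, the quantity `c * r ^ m` is bounded uniformly over all `c ≤ m`. -/
lemma exists_forall_mul_pow_le_of_le_natCast {r : ℝ} (hr0 : 0 ≤ r) (hr1 : r < 1) :
    ∃ B : ℝ, ∀ (c : ℝ) (m : ℕ), c ≤ m → c * r ^ m ≤ B := by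
  obtain ⟨B, hB⟩ := (tendsto_self_mul_const_pow_of_lt_one hr0 hr1).bddAbove_range
  exact ⟨B, fun c m hcm =>
    (mul_le_mul_of_nonneg_right hcm (pow_nonneg hr0 m)).trans (hB ⟨m, rfl⟩)⟩

/-- If `C_k > 0` and `N_k ≥ ⌈C_k⌉ + k(4k+1)` for all `k ≥ 1`, then for every `0 < r < 1` the
series `Σ_{k=1}^∞ C_k r^{N_k} / (1-r)^{4k+1}` converges. -/
theorem summable_of_large_exponents (C : ℕ → ℝ) (N : ℕ → ℕ)
    (hC : ∀ k : ℕ, 1 ≤ k → 0 < C k)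
    (hN : ∀ k : ℕ, 1 ≤ k → (⌈C k⌉ + (k : ℤ) * (4 * k + 1) : ℤ) ≤ (N k : ℤ))
    (r : ℝ) (hr0 : 0 < r) (hr1 : r < 1) :
    Summable fun k : ℕ =>
      C (k + 1) * r ^ N (k + 1) / (1 - r) ^ (4 * (k + 1) + 1) := by
  have hr : 0 < 1 - r := sub_pos.2 hr1
  obtain ⟨B, hB⟩ := exists_forall_mul_pow_le_of_le_natCast hr0.le hr1
  have hratio : ∀ᶠ k : ℕ in Filter.atTop, r ^ (k + 1) / (1 - r) ≤ 1 / 2 := by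
    have h := ((tendsto_pow_atTop_nhds_zero_of_lt_one hr0.le hr1).comp
      (Filter.tendsto_add_atTop_nat 1)).div_const (1 - r)
    rw [zero_div] at h
    exact h.eventually_le_const (by norm_num)
  refine Summable.of_norm_bounded_eventually_nat (g := fun k => B * (1 / 2 : ℝ) ^ k)
    (summable_geometric_two.mul_left B) ?_
  filter_upwards [hratio] with k hk
  have hCk := hC (k + 1) k.succ_pos
  have hceil : (⌈C (k + 1)⌉₊ : ℤ) = ⌈C (k + 1)⌉ := Int.natCast_ceil_eq_ceil hCk.le
  have hNk : ⌈C (k + 1)⌉₊ + (k + 1) * (4 * (k + 1) + 1) ≤ N (k + 1) := by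
    zify
    rw [hceil]
    exact_mod_cast hN (k + 1) k.succ_pos
  have hbound := hB _ _ (Nat.le_ceil (C (k + 1)))
  have hB0 : 0 ≤ B := le_trans (by positivity) hbound
  rw [Real.norm_of_nonneg (by positivity)]
  calc C (k + 1) * r ^ N (k + 1) / (1 - r) ^ (4 * (k + 1) + 1)
      ≤ C (k + 1) * r ^ (⌈C (k + 1)⌉₊ + (k + 1) * (4 * (k + 1) + 1))
          / (1 - r) ^ (4 * (k + 1) + 1) := by
        gcongr ?_ * ?_ / _
        exact pow_le_pow_of_le_one hr0.le hr1.le hNk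
    _ = C (k + 1) * r ^ ⌈C (k + 1)⌉₊ * (r ^ (k + 1) / (1 - r)) ^ (4 * (k + 1) + 1) := by
        rw [pow_add, pow_mul, div_pow, ← mul_assoc, mul_div_assoc]
    _ ≤ B * (1 / 2) ^ (4 * (k + 1) + 1) := by gcongr
    _ ≤ B * (1 / 2) ^ k :=
        mul_le_mul_of_nonneg_left
          (pow_le_pow_of_le_one (by norm_num) (by norm_num) (by lia)) hB0
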